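/- Let d ≥ 0 be an integer and a, b, c ∈ F, and suppose the ℜ-module R_d(a,b,c) is irreducible. Then the following are equivalent: (i) A, B, C act diagonalizably on R_d(a,b,c); (ii) A, B, C act multiplicity-freely on R_d(a,b,c); (iii) A, B, C act as a Leonard triple on R_d(a,b,c). -/

import Mathlib

open FreeAlgebra

noncomputable section

variable (F : Type) [Field F]

/-! ## The universal Racah algebra -/

/-- `α = [A,D] + AC - BA` in the free algebra on `A,B,C,D`. -/
def alphaFree : FreeAlgebra F (Fin 4) :=
  ι F 0 * ι F 3 - ι F 3 * ι F 0 + ι F 0 * ι F 2 - ι F 1 * ι F 0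

/-- `β = [B,D] + BA - CB` in the free algebra on `A,B,C,D`. -/
def betaFree : FreeAlgebra F (Fin 4) :=
  ι F 1 * ι F 3 - ι F 3 * ι F 1 + ι F 1 * ι F 0 - ι F 2 * ι F 1

/-- `γ = [C,D] + CB - AC` in the free algebra on `A,B,C,D`. -/
def gammaFree : FreeAlgebra F (Fin 4) :=
  ι F 2 * ι F 3 - ι F 3 * ι F 2 + ι F 2 * ι F 1 - ι F 0 * ι F 2

/-- The defining relations of the universal Racah algebra:
`[A,B] = [B,C] = [C,A] = 2D` and `α`, `β`, `γ` commute with the generators. -/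
inductive RacahRel : FreeAlgebra F (Fin 4) → FreeAlgebra F (Fin 4) → Prop
  | AB : RacahRel (ι F 0 * ι F 1 - ι F 1 * ι F 0) (2 * ι F 3)
  | BC : RacahRel (ι F 1 * ι F 2 - ι F 2 * ι F 1) (2 * ι F 3)
  | CA : RacahRel (ι F 2 * ι F 0 - ι F 0 * ι F 2) (2 * ι F 3)
  | alphaC (i : Fin 4) : RacahRel (alphaFree F * ι F i) (ι F i * alphaFree F)
  | betaC (i : Fin 4) : RacahRel (betaFree F * ι F i) (ι F i * betaFree F)
  | gammaC (i : Fin 4) : RacahRel (gammaFree F * ι F i) (ι F i * gammaFree F)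

/-- The universal Racah algebra `ℜ`. -/
abbrev RacahAlg := RingQuot (RacahRel F)

def rA : RacahAlg F := RingQuot.mkAlgHom F (RacahRel F) (ι F 0)
def rB : RacahAlg F := RingQuot.mkAlgHom F (RacahRel F) (ι F 1)
def rC : RacahAlg F := RingQuot.mkAlgHom F (RacahRel F) (ι F 2)
def rD : RacahAlg F := RingQuot.mkAlgHom F (RacahRel F) (ι F 3)
def rDelta : RacahAlg F := rA F + rB F + rC F
def rAlpha : RacahAlg F := RingQuot.mkAlgHom F (RacahRel F) (alphaFree F)
def rBeta : RacahAlg F := RingQuot.mkAlgHom F (RacahRel F) (betaFree F)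
def rGamma : RacahAlg F := RingQuot.mkAlgHom F (RacahRel F) (gammaFree F)

/-! ## The universal additive DAHA of type `(C₁∨, C₁)` -/

/-- The defining relations: `t₀ + t₁ + t₂ + t₃ = -1` and each `tᵢ²` is central. -/
inductive DAHARel : FreeAlgebra F (Fin 4) → FreeAlgebra F (Fin 4) → Prop
  | sum : DAHARel (ι F 0 + ι F 1 + ι F 2 + ι F 3) (-1)
  | central (i j : Fin 4) : DAHARel (ι F i * ι F i * ι F j) (ι F j * (ι F i * ι F i))

/-- The universal additive DAHA `𝔥` of type `(C₁∨, C₁)`. -/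
abbrev DAHAAlg := RingQuot (DAHARel F)

/-- The generators `t₀, t₁, t₂, t₃` of `𝔥`. -/
def tGen (i : Fin 4) : DAHAAlg F := RingQuot.mkAlgHom F (DAHARel F) (ι F i)

/-! ## Scalar restriction along `algebraMap`, actions as `F`-linear operators -/

/-- The `F`-vector space structure on a module over an `F`-algebra `A`. -/
def resF (A : Type) [Ring A] [Algebra F A] (W : Type) [AddCommGroup W] [Module A W] :
    Module F W := Module.compHom W (algebraMap F A)

theorem resF_tower (A : Type) [Ring A] [Algebra F A] (W : Type) [AddCommGroup W] [Module A W]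
    [instF : Module F W] (h : instF = resF F A W) : IsScalarTower F A W := by
  have key : ∀ (a : F) (u : W), a • u = algebraMap F A a • u := by
    intro a u; rw [h]; rfl
  exact ⟨fun a x w => by rw [Algebra.smul_def, mul_smul, key a (x • w)]⟩

/-- The action of `x : A` on an `A`-module `W` as an `F`-linear operator. -/
def opOf {A : Type} [Ring A] [Algebra F A] (x : A) (W : Type) [AddCommGroup W] [Module F W]
    [Module A W] [IsScalarTower F A W] : Module.End F W where
  toFun w := x • w
  map_add' u v := smul_add x u v
  map_smul' a w := by
    simp only [RingHom.id_apply]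
    rw [← algebraMap_smul A a w, ← mul_smul, ← Algebra.commutes, mul_smul, algebraMap_smul]

/-- `x : A` acts diagonalizably on the `A`-module `W`. -/
def ActsDiagOn {A : Type} [Ring A] [Algebra F A] (x : A) (W : Type) [AddCommGroup W]
    [Module A W] : Prop :=
  letI := resF F A W
  haveI := resF_tower F A W rfl
  (⨆ μ : F, Module.End.eigenspace (opOf F x W) μ) = ⊤

/-- `x : A` acts on the `A`-module `W` in a multiplicity-free way: every eigenvalue of the
action of `x` has algebraic multiplicity one. -/
def ActsMultFreeOn {A : Type} [Ring A] [Algebra F A] (x : A) (W : Type) [AddCommGroup W]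
    [Module A W] : Prop :=
  letI := resF F A W
  haveI := resF_tower F A W rfl
  ∀ μ : F, Module.End.HasEigenvalue (opOf F x W) μ →
    Module.finrank F (Module.End.maxGenEigenspace (opOf F x W) μ) = 1

/-- `x : A` acts on the `A`-module `W` as scalar multiplication by `μ : F`. -/
def actsAsScalar {A : Type} [Ring A] [Algebra F A] (x : A) (μ : F) (W : Type)
    [AddCommGroup W] [Module A W] : Prop :=
  letI := resF F A W
  ∀ u : W, x • u = μ • u

/-- The trace of the action of `x : A` on the `A`-module `W`. -/
def traceOf {A : Type} [Ring A] [Algebra F A] (x : A) (W : Type) [AddCommGroup W]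
    [Module A W] : F :=
  letI := resF F A W
  haveI := resF_tower F A W rfl
  LinearMap.trace F W (opOf F x W)

/-! ## Tridiagonal matrices, Leonard pairs and Leonard triples -/

/-- A square matrix is tridiagonal if each nonzero entry lies on the diagonal, the
superdiagonal, or the subdiagonal. -/
def IsTridiag {n : ℕ} (M : Matrix (Fin n) (Fin n) F) : Prop :=
  ∀ i j : Fin n, M i j ≠ 0 → (i : ℕ) = (j : ℕ) ∨ (i : ℕ) = (j : ℕ) + 1 ∨ (j : ℕ) = (i : ℕ) + 1

/-- A tridiagonal matrix is irreducible if every superdiagonal and subdiagonal entry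
is nonzero. -/
def IsIrrTridiag {n : ℕ} (M : Matrix (Fin n) (Fin n) F) : Prop :=
  IsTridiag F M ∧ ∀ i j : Fin n, ((i : ℕ) = (j : ℕ) + 1 ∨ (j : ℕ) = (i : ℕ) + 1) → M i j ≠ 0

/-- `x, y : A` act on the `A`-module `W` as a Leonard pair. -/
def ActsAsLeonardPairOn {A : Type} [Ring A] [Algebra F A] (x y : A) (W : Type)
    [AddCommGroup W] [Module A W] : Prop :=
  letI := resF F A W
  haveI := resF_tower F A W rfl
  (∃ (n : ℕ) (b : Module.Basis (Fin n) F W),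
      (LinearMap.toMatrix b b (opOf F x W)).IsDiag ∧
      IsIrrTridiag F (LinearMap.toMatrix b b (opOf F y W))) ∧
  (∃ (n : ℕ) (b : Module.Basis (Fin n) F W),
      (LinearMap.toMatrix b b (opOf F y W)).IsDiag ∧
      IsIrrTridiag F (LinearMap.toMatrix b b (opOf F x W)))

/-- `x, y, z : A` act on the `A`-module `W` as a Leonard triple. -/
def ActsAsLeonardTripleOn {A : Type} [Ring A] [Algebra F A] (x y z : A) (W : Type)
    [AddCommGroup W] [Module A W] : Prop :=
  letI := resF F A W
  haveI := resF_tower F A W rfl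
  (∃ (n : ℕ) (b : Module.Basis (Fin n) F W),
      (LinearMap.toMatrix b b (opOf F x W)).IsDiag ∧
      IsIrrTridiag F (LinearMap.toMatrix b b (opOf F y W)) ∧
      IsIrrTridiag F (LinearMap.toMatrix b b (opOf F z W))) ∧
  (∃ (n : ℕ) (b : Module.Basis (Fin n) F W),
      (LinearMap.toMatrix b b (opOf F y W)).IsDiag ∧
      IsIrrTridiag F (LinearMap.toMatrix b b (opOf F z W)) ∧
      IsIrrTridiag F (LinearMap.toMatrix b b (opOf F x W))) ∧
  (∃ (n : ℕ) (b : Module.Basis (Fin n) F W),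
      (LinearMap.toMatrix b b (opOf F z W)).IsDiag ∧
      IsIrrTridiag F (LinearMap.toMatrix b b (opOf F x W)) ∧
      IsIrrTridiag F (LinearMap.toMatrix b b (opOf F y W)))

/-! ## The irreducible `ℜ`-modules `R_d(a,b,c)` -/

/-- `θᵢ = (x + d/2 - i)(x + d/2 - i + 1)`. -/
def thP (x : F) (d i : ℕ) : F := (x + (d : F) / 2 - (i : F)) * (x + (d : F) / 2 - (i : F) + 1)

/-- `φᵢ = i(i-d-1)(a+b+c+d/2-i+2)(a+b-c+d/2-i+1)`. -/
def phP (a b c : F) (d i : ℕ) : F :=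
  (i : F) * ((i : F) - (d : F) - 1) * (a + b + c + (d : F) / 2 - (i : F) + 2) *
    (a + b - c + (d : F) / 2 - (i : F) + 1)

/-- `W` is (a copy of) the `(d+1)`-dimensional `ℜ`-module `R_d(a,b,c)`:  there is a basis
with respect to which `A` is lower bidiagonal with diagonal `θᵢ` and subdiagonal entries `1`,
`B` is upper bidiagonal with diagonal `θᵢ*` and superdiagonal entries `φᵢ`, and `δ` acts as
the prescribed scalar. -/
def IsRdModule (a b c : F) (d : ℕ) (W : Type) [AddCommGroup W] [Module (RacahAlg F) W] :
    Prop :=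
  letI := resF F (RacahAlg F) W
  ∃ v : Module.Basis (Fin (d + 1)) F W,
    (∀ i : Fin (d + 1), rA F • (v i : W) = thP F a d i • v i +
      (if h : (i : ℕ) + 1 < d + 1 then v ⟨(i : ℕ) + 1, h⟩ else 0)) ∧
    (∀ i : Fin (d + 1), rB F • (v i : W) = thP F b d i • v i +
      (if (i : ℕ) = 0 then 0 else
        phP F a b c d i • v ⟨(i : ℕ) - 1, lt_of_le_of_lt (Nat.sub_le _ _) i.isLt⟩)) ∧
    actsAsScalar F (rDelta F)
      ((d : F) / 2 * ((d : F) / 2 + 1) + a * (a + 1) + b * (b + 1) + c * (c + 1)) W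

/-! ## The homomorphism `ζ : ℜ → 𝔥` -/

/-- `ζ : ℜ → 𝔥` sends `A, B, C` to the prescribed elements of `𝔥`. -/
def IsZeta (ζ : RacahAlg F →ₐ[F] DAHAAlg F) : Prop :=
  ζ (rA F) = (1 / 4 : F) • ((tGen F 0 + tGen F 1 - 1) * (tGen F 0 + tGen F 1 + 1)) ∧
  ζ (rB F) = (1 / 4 : F) • ((tGen F 0 + tGen F 2 - 1) * (tGen F 0 + tGen F 2 + 1)) ∧
  ζ (rC F) = (1 / 4 : F) • ((tGen F 0 + tGen F 3 - 1) * (tGen F 0 + tGen F 3 + 1))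

/-- A `𝔥`-module considered as an `ℜ`-module via `ζ : ℜ → 𝔥`. -/
def racahModOfDaha (ζ : RacahAlg F →ₐ[F] DAHAAlg F) (V : Type) [AddCommGroup V]
    [Module (DAHAAlg F) V] : Module (RacahAlg F) V :=
  Module.compHom V ζ.toRingHom

/-! ## Composition factors -/

/-- The `i`-th factor of a composition series of submodules. -/
abbrev csFactor {R V : Type} [Ring R] [AddCommGroup V] [Module R V]
    (s : CompositionSeries (Submodule R V)) (i : Fin s.length) : Type :=
  (↥(s i.succ)) ⧸ Submodule.comap (s i.succ).subtype (s i.castSucc)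

/-! ## The `𝔥`-modules `E_d(a,b,c)` and `O_d(a,b,c)` -/

def sigP (a b c : F) (d : ℕ) : F := a + b + c - ((d : F) + 1) / 2
def tauP (a b c : F) (d : ℕ) : F := a + b - c - ((d : F) + 1) / 2
def lamP (a b c : F) (d : ℕ) : F := a - b - c - ((d : F) + 1) / 2
def muP (a b c : F) (d : ℕ) : F := c - a - b - ((d : F) + 1) / 2
def nuP (a b c : F) (d : ℕ) : F := b - a - c - ((d : F) + 1) / 2

/-- `W` is (a copy of) the `(d+1)`-dimensional `𝔥`-module `E_d(a,b,c)` (`d` odd):  there is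
a basis `v₀, …, v_d` (extended by zero to a sequence `w`) on which `t₀, t₁, t₂, t₃` act by the
prescribed formulas. -/
def IsEdModule (a b c : F) (d : ℕ) (W : Type) [AddCommGroup W] [Module (DAHAAlg F) W] :
    Prop :=
  letI := resF F (DAHAAlg F) W
  ∃ (v : Module.Basis (Fin (d + 1)) F W) (w : ℕ → W),
    (∀ i : Fin (d + 1), w i = v i) ∧ (∀ n : ℕ, d < n → w n = 0) ∧
    (∀ i : ℕ, Even i → 2 ≤ i → i + 1 ≤ d →
      tGen F 0 • w i = ((i : F) * ((d : F) - (i : F) + 1)) • w (i - 1)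
        - (((d : F) - 2 * (i : F) + 1) / 2) • w i) ∧
    (∀ i : ℕ, Odd i → i + 2 ≤ d →
      tGen F 0 • w i = (((d : F) - 2 * (i : F) - 1) / 2) • w i + w (i + 1)) ∧
    (tGen F 0 • w 0 = -(((d : F) + 1) / 2) • w 0) ∧
    (tGen F 0 • w d = -(((d : F) + 1) / 2) • w d) ∧
    (∀ i : ℕ, Even i → 2 ≤ i → i + 1 ≤ d →
      tGen F 1 • w i = ((i : F) * ((i : F) - (d : F) - 1)) • w (i - 1) + a • w i + w (i + 1)) ∧
    (∀ i : ℕ, Odd i → i ≤ d → tGen F 1 • w i = -a • w i) ∧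
    (tGen F 1 • w 0 = a • w 0 + w 1) ∧
    (∀ i : ℕ, Even i → i + 1 ≤ d → tGen F 2 • w i = b • w i) ∧
    (∀ i : ℕ, Odd i → i + 2 ≤ d →
      tGen F 2 • w i = -((sigP F a b c d + (i : F)) * (tauP F a b c d + (i : F))) • w (i - 1)
        - b • w i - w (i + 1)) ∧
    (tGen F 2 • w d = -((sigP F a b c d + (d : F)) * (tauP F a b c d + (d : F))) • w (d - 1)
      - b • w d) ∧
    (∀ i : ℕ, Even i → i + 1 ≤ d →
      tGen F 3 • w i = -((sigP F a b c d + tauP F a b c d + 2 * (i : F) + 2) / 2) • w i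
        - w (i + 1)) ∧
    (∀ i : ℕ, Odd i → i ≤ d →
      tGen F 3 • w i = ((sigP F a b c d + (i : F)) * (tauP F a b c d + (i : F))) • w (i - 1)
        + ((sigP F a b c d + tauP F a b c d + 2 * (i : F)) / 2) • w i)

/-- On `E_d(a,b,c)` the elements `t₀², t₁², t₂², t₃²` act as scalar multiplication by
`(d+1)²/4, a², b², c²` respectively. -/
def EdSquares (a b c : F) (d : ℕ) (W : Type) [AddCommGroup W] [Module (DAHAAlg F) W] :
    Prop :=
  actsAsScalar F (tGen F 0 * tGen F 0) (((d : F) + 1) ^ 2 / 4) W ∧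
  actsAsScalar F (tGen F 1 * tGen F 1) (a ^ 2) W ∧
  actsAsScalar F (tGen F 2 * tGen F 2) (b ^ 2) W ∧
  actsAsScalar F (tGen F 3 * tGen F 3) (c ^ 2) W

/-- `W` is (a copy of) the `(d+1)`-dimensional `𝔥`-module `O_d(a,b,c)` (`d` even):  there is
a basis `v₀, …, v_d` (extended by zero to a sequence `w`) on which `t₀, t₁, t₂, t₃` act by the
prescribed formulas. -/
def IsOdModule (a b c : F) (d : ℕ) (W : Type) [AddCommGroup W] [Module (DAHAAlg F) W] :
    Prop :=
  letI := resF F (DAHAAlg F) W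
  ∃ (v : Module.Basis (Fin (d + 1)) F W) (w : ℕ → W),
    (∀ i : Fin (d + 1), w i = v i) ∧ (∀ n : ℕ, d < n → w n = 0) ∧
    (∀ i : ℕ, Even i → 2 ≤ i → i ≤ d →
      tGen F 0 • w i = -((i : F) * (sigP F a b c d + (i : F))) • w (i - 1)
        + ((sigP F a b c d + 2 * (i : F)) / 2) • w i) ∧
    (∀ i : ℕ, Odd i → i + 1 ≤ d →
      tGen F 0 • w i = -((sigP F a b c d + 2 * (i : F) + 2) / 2) • w i + w (i + 1)) ∧
    (tGen F 0 • w 0 = (sigP F a b c d / 2) • w 0) ∧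
    (∀ i : ℕ, Even i → 2 ≤ i → i + 2 ≤ d →
      tGen F 1 • w i = ((i : F) * (sigP F a b c d + (i : F))) • w (i - 1)
        + (lamP F a b c d / 2) • w i + w (i + 1)) ∧
    (∀ i : ℕ, Odd i → i + 1 ≤ d → tGen F 1 • w i = -(lamP F a b c d / 2) • w i) ∧
    (tGen F 1 • w 0 = (lamP F a b c d / 2) • w 0 + w 1) ∧
    (tGen F 1 • w d = ((d : F) * (sigP F a b c d + (d : F))) • w (d - 1)
      + (lamP F a b c d / 2) • w d) ∧
    (∀ i : ℕ, Even i → i ≤ d → tGen F 2 • w i = (nuP F a b c d / 2) • w i) ∧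
    (∀ i : ℕ, Odd i → i + 1 ≤ d →
      tGen F 2 • w i = (((d : F) - (i : F) - 1) * (tauP F a b c d + (i : F))) • w (i - 1)
        - (nuP F a b c d / 2) • w i - w (i + 1)) ∧
    (∀ i : ℕ, Even i → i + 2 ≤ d →
      tGen F 3 • w i = ((2 * (d : F) + muP F a b c d - 2 * (i : F)) / 2) • w i - w (i + 1)) ∧
    (∀ i : ℕ, Odd i → i + 1 ≤ d →
      tGen F 3 • w i = (((i : F) - (d : F) - 1) * (tauP F a b c d + (i : F))) • w (i - 1)
        - ((2 * (d : F) + muP F a b c d - 2 * (i : F) + 2) / 2) • w i) ∧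
    (tGen F 3 • w d = (muP F a b c d / 2) • w d)

/-- On `O_d(a,b,c)` the elements `t₀², t₁², t₂², t₃²` act as the prescribed scalars. -/
def OdSquares (a b c : F) (d : ℕ) (W : Type) [AddCommGroup W] [Module (DAHAAlg F) W] :
    Prop :=
  actsAsScalar F (tGen F 0 * tGen F 0) (((a + b + c) / 2 - ((d : F) + 1) / 4) ^ 2) W ∧
  actsAsScalar F (tGen F 1 * tGen F 1) (((a - b - c) / 2 - ((d : F) + 1) / 4) ^ 2) W ∧
  actsAsScalar F (tGen F 2 * tGen F 2) (((c - a - b) / 2 - ((d : F) + 1) / 4) ^ 2) W ∧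
  actsAsScalar F (tGen F 3 * tGen F 3) (((b - a - c) / 2 - ((d : F) + 1) / 4) ^ 2) W

/-! ## The `{±1}²`-action on `𝔥` and twisted modules -/

theorem dahaSum : tGen F 0 + tGen F 1 + tGen F 2 + tGen F 3 = -1 := by
  have h := RingQuot.mkAlgHom_rel F (DAHARel.sum (F := F))
  simpa [tGen] using h

theorem dahaSqCentral (i j : Fin 4) :
    tGen F i * tGen F i * tGen F j = tGen F j * (tGen F i * tGen F i) := by
  have h := RingQuot.mkAlgHom_rel F (DAHARel.central (F := F) i j)
  simpa [tGen] using h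

/-- The algebra endomorphism of `𝔥` permuting the generators `t₀, t₁, t₂, t₃` by `π`. -/
def dahaAut (π : Equiv.Perm (Fin 4)) : DAHAAlg F →ₐ[F] DAHAAlg F :=
  RingQuot.liftAlgHom F ⟨FreeAlgebra.lift F (fun i => tGen F (π i)), by
    intro x y h
    cases h with
    | sum =>
        simp only [map_add, map_neg, map_one, FreeAlgebra.lift_ι_apply]
        have h4 : tGen F (π 0) + tGen F (π 1) + tGen F (π 2) + tGen F (π 3)
            = ∑ k : Fin 4, tGen F (π k) := by rw [Fin.sum_univ_four]
        rw [h4, Equiv.sum_comp π (tGen F), Fin.sum_univ_four, dahaSum]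
    | central i j =>
        simp only [map_mul, FreeAlgebra.lift_ι_apply]
        exact dahaSqCentral F (π i) (π j)⟩

/-- The element of the Klein group `{±1}²` acting on `𝔥` as the permutation of
`(t₀, t₁, t₂, t₃)` from Table 1. -/
def permOf (ε : ℤˣ × ℤˣ) : Equiv.Perm (Fin 4) :=
  if ε = (1, 1) then 1
  else if ε = (1, -1) then Equiv.swap 0 1 * Equiv.swap 2 3
  else if ε = (-1, 1) then Equiv.swap 0 2 * Equiv.swap 1 3
  else Equiv.swap 0 3 * Equiv.swap 1 2

/-- The `𝔥`-module `W^ε`: the underlying space of `W` with the action twisted by the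
automorphism of `𝔥` given by the permutation `π` of the generators. -/
def twMod (π : Equiv.Perm (Fin 4)) (W : Type) [AddCommGroup W] [Module (DAHAAlg F) W] :
    Module (DAHAAlg F) W :=
  Module.compHom W (dahaAut F π).toRingHom

/-- The trace of `x` on the twisted module `W^π`. -/
def twTrace (π : Equiv.Perm (Fin 4)) (x : DAHAAlg F) (W : Type) [AddCommGroup W]
    [Module (DAHAAlg F) W] : F :=
  @traceOf F _ (DAHAAlg F) _ _ x W _ (twMod F π W)

/-- `x` acts on the twisted module `W^π` as scalar multiplication by `μ`. -/
def twActsAsScalar (π : Equiv.Perm (Fin 4)) (x : DAHAAlg F) (μ : F) (W : Type)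
    [AddCommGroup W] [Module (DAHAAlg F) W] : Prop :=
  @actsAsScalar F _ (DAHAAlg F) _ _ x μ W _ (twMod F π W)

/-- The twisted module `W^π` is (a copy of) `E_d(a,b,c)`. -/
def twIsEdModule (π : Equiv.Perm (Fin 4)) (a b c : F) (d : ℕ) (W : Type) [AddCommGroup W]
    [Module (DAHAAlg F) W] : Prop :=
  @IsEdModule F _ a b c d W _ (twMod F π W)

end

/-- Eigenvalues of the generators of the universal Racah algebra are parametrized as
`x (x + 1)`; generators move the parameter `x` by at most one. -/
def racahEig {K : Type*} [Field K] (x : K) : K := x * (x + 1)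

theorem racahEig_eq_iff {K : Type*} [Field K] (x y : K) :
    racahEig x = racahEig y ↔ x = y ∨ x + y + 1 = 0 := by
  unfold racahEig
  rw [← sub_eq_zero, ← sub_eq_zero (a := x), ← mul_eq_zero]
  ring_nf

theorem racahEig_adjacent {K : Type*} [Field K] {x s : K}
    (h : (s - racahEig x) ^ 2 = 2 * (s + racahEig x)) :
    s = racahEig (x + 1) ∨ s = racahEig (x - 1) := by
  have : (s - racahEig (x + 1)) * (s - racahEig (x - 1)) = 0 := by
    unfold racahEig at *
    linear_combination h
  rcases mul_eq_zero.1 this with h | h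
  · exact Or.inl (sub_eq_zero.1 h)
  · exact Or.inr (sub_eq_zero.1 h)

theorem exists_racahEig_eq {K : Type*} [Field K] [IsAlgClosed K] (s : K) :
    ∃ x, racahEig x = s := by
  obtain ⟨x, hx⟩ := IsAlgClosed.exists_root
    (Polynomial.X ^ 2 + Polynomial.X - Polynomial.C s : Polynomial K)
    (by
      have : (Polynomial.X ^ 2 + Polynomial.X - Polynomial.C s : Polynomial K).degree = 2 := by
        compute_degree!
      rw [this]
      decide)
  refine ⟨x, ?_⟩
  simp [Polynomial.IsRoot] at hx
  unfold racahEig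
  linear_combination hx

theorem exists_racahEig_top {K : Type*} [Field K] [IsAlgClosed K] [CharZero K] (S : Finset K)
    (hS : S.Nonempty) : ∃ x, racahEig x ∈ S ∧ racahEig (x + 1) ∉ S := by
  by_contra! hstep
  obtain ⟨s, hs⟩ := hS
  obtain ⟨x, rfl⟩ := exists_racahEig_eq s
  have hall : ∀ n : ℕ, racahEig (x + n) ∈ S := by
    intro n
    induction n with
    | zero => simpa using hs
    | succ n ih => simpa [add_assoc] using hstep _ ih
  obtain ⟨n, hn⟩ : ∃ n : ℕ, ∀ m : ℕ, n ≤ m → ∀ l : ℕ, n ≤ l →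
      x + m + (x + l) + 1 ≠ 0 := by
    by_cases h : ∃ N : ℕ, 2 * x + 1 + N = 0
    · obtain ⟨N, hN⟩ := h
      refine ⟨N + 1, fun m hm l hl h0 => ?_⟩
      have : ((m + l : ℕ) : K) = N := by push_cast; linear_combination h0 - hN
      have := Nat.cast_injective this
      omega
    · push Not at h
      refine ⟨0, fun m _ l _ h0 => h (m + l) ?_⟩
      push_cast
      linear_combination h0
  refine Set.infinite_of_injective_forall_mem (s := (S : Set K))
    (f := fun m : ℕ => racahEig (x + (n + m : ℕ))) ?_ (fun m => hall _) S.finite_toSet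
  intro m l h
  rcases (racahEig_eq_iff _ _).1 h with h | h
  · have := Nat.cast_injective (add_left_cancel h)
    omega
  · exact absurd h (hn _ (by omega) _ (by omega))

/-- A finite set of scalars contains a finite sequence of distinct elements that is a connected
component for the relation `(s - t) ^ 2 = 2 * (s + t)`, with consecutive elements being the only
related ones. -/
theorem exists_racahEig_path {K : Type*} [Field K] [IsAlgClosed K] [CharZero K] (S : Finset K)
    (hS : S.Nonempty) : ∃ (k : ℕ) (θ : Fin (k + 1) → K), Function.Injective θ ∧
      (∀ i, θ i ∈ S) ∧
      (∀ i, ∀ s ∈ S, (s - θ i) ^ 2 = 2 * (s + θ i) → s ∈ Set.range θ) ∧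
      ∀ i j, i ≠ j → (θ i - θ j) ^ 2 = 2 * (θ i + θ j) →
        (i : ℕ) = (j : ℕ) + 1 ∨ (j : ℕ) = (i : ℕ) + 1 := by
  obtain ⟨x, hx, hx1⟩ := exists_racahEig_top S hS
  let P : ℕ → Prop := fun k => (∀ i ≤ k, racahEig (x - i) ∈ S) ∧
    Set.InjOn (fun i : ℕ => racahEig (x - i)) (Set.Iic k)
  have hP0 : P 0 := by
    refine ⟨fun i hi => ?_, fun i hi j hj _ => ?_⟩
    · obtain rfl : i = 0 := by omega
      simpa using hx
    · simp only [Set.mem_Iic] at hi hj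
      omega
  have hbdd : ∃ k, P k ∧ ¬ P (k + 1) := by
    by_contra! h
    have hall : ∀ k, P k := fun k => Nat.rec hP0 h k
    refine Set.infinite_of_injective_forall_mem (s := (S : Set K))
      (f := fun m : ℕ => racahEig (x - m)) ?_ (fun m => (hall m).1 m le_rfl) S.finite_toSet
    intro i j hij
    exact (hall (max i j)).2 (by simp) (by simp) hij
  obtain ⟨k, ⟨hmem, hinj⟩, hk⟩ := hbdd
  have hlast : racahEig (x - (k + 1 : ℕ)) ∈ S →
      ∃ j ≤ k, racahEig (x - j) = racahEig (x - (k + 1 : ℕ)) := by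
    intro hin
    by_contra! hne
    refine hk ⟨fun i hi => ?_, fun i hi j hj hij => ?_⟩
    · rcases Nat.lt_or_ge k i with h | h
      · obtain rfl : i = k + 1 := by omega
        exact hin
      · exact hmem i h
    · simp only [Set.mem_Iic] at hi hj
      rcases Nat.lt_or_ge k i with h | h <;> rcases Nat.lt_or_ge k j with h' | h'
      · omega
      · obtain rfl : i = k + 1 := by omega
        exact absurd hij.symm (hne j h')
      · obtain rfl : j = k + 1 := by omega
        exact absurd hij (hne i h)
      · exact hinj h h' hij
  have hsucc : ∀ i : ℕ, x - i - 1 = x - (i + 1 : ℕ) := fun i => by push_cast; ring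
  have hpred : ∀ i : ℕ, x - (i + 1 : ℕ) + 1 = x - i := fun i => by push_cast; ring
  refine ⟨k, fun i => racahEig (x - (i : ℕ)), ?_, fun i => hmem _ (by omega), ?_, ?_⟩
  · intro i j hij
    exact Fin.ext (hinj (Nat.le_of_lt_succ i.2) (Nat.le_of_lt_succ j.2) hij)
  · rintro ⟨i, hi⟩ s hs h
    rcases racahEig_adjacent h with rfl | rfl
    · cases i with
      | zero => simp [hx1] at hs
      | succ i => exact ⟨⟨i, by omega⟩, by simp only [hpred]⟩
    · simp only [hsucc] at hs ⊢
      rcases Nat.lt_or_ge i k with h' | h'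
      · exact ⟨⟨i + 1, by omega⟩, rfl⟩
      · obtain rfl : i = k := by omega
        obtain ⟨j, hj, hjk⟩ := hlast hs
        exact ⟨⟨j, by omega⟩, hjk⟩
  · rintro ⟨i, hi⟩ ⟨j, hj⟩ hij h
    simp only [ne_eq, Fin.mk.injEq] at hij ⊢
    have hieq := hmem i (by omega)
    rcases racahEig_adjacent h with h | h
    · cases j with
      | zero => simp only [h] at hieq; simp [hx1] at hieq
      | succ j =>
        simp only [hpred] at h
        have := hinj (show i ∈ Set.Iic k by simp; omega) (show j ∈ Set.Iic k by simp; omega) h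
        omega
    · have heq : racahEig (x - i) = racahEig (x - (j + 1 : ℕ)) := by simpa only [hsucc] using h
      rcases Nat.lt_or_ge j k with h' | h'
      · have := hinj (show i ∈ Set.Iic k by simp; omega)
          (show j + 1 ∈ Set.Iic k by simp; omega) heq
        omega
      · obtain rfl : j = k := by omega
        by_contra! hcon
        rcases (racahEig_eq_iff _ _).1 heq with h₁ | h₁
        · have := Nat.cast_injective (sub_right_injective h₁)
          omega
        · have : racahEig (x - (i + 1 : ℕ)) = racahEig (x - j) := by
            refine (racahEig_eq_iff _ _).2 (Or.inr ?_)
            push_cast at h₁ ⊢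
            linear_combination h₁
          have := hinj (show i + 1 ∈ Set.Iic j by simp; omega) (show j ∈ Set.Iic j by simp) this
          omega

open Module in
/-- An operator admitting a cyclic vector and diagonalizable is multiplicity-free. -/
theorem Module.End.finrank_maxGenEigenspace_of_cyclic {K V : Type*} [Field K] [AddCommGroup V]
    [Module K V] [FiniteDimensional K V] {X : End K V} (hX : ⨆ μ : K, X.eigenspace μ = ⊤)
    {v : V} (hv : ∀ W : Submodule K V, v ∈ W → (∀ w ∈ W, X w ∈ W) → W = ⊤) {μ : K}
    (hμ : X.HasEigenvalue μ) : finrank K (X.maxGenEigenspace μ) = 1 := by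
  have heq : X.eigenspace = X.maxGenEigenspace :=
    (X.independent_maxGenEigenspace.le_iff_eq_of_iSup_eq_top hX).1
      fun μ => (X.genEigenspace μ).monotone le_top
  rw [← heq]
  refine le_antisymm ?_ (Submodule.one_le_finrank_iff.2 hμ)
  set Y : End K V := X - algebraMap K (End K V) μ with hY
  have hYv : ∀ w, Y w = X w - μ • w := fun w => rfl
  have htop : K ∙ v ⊔ LinearMap.range Y = ⊤ := by
    refine hv _ (Submodule.mem_sup_left (Submodule.mem_span_singleton_self v)) fun w hw => ?_
    have : X w = Y w + μ • w := by rw [hYv]; abel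
    rw [this]
    exact add_mem (Submodule.mem_sup_right (LinearMap.mem_range_self Y w))
      (Submodule.smul_mem _ _ hw)
  have h1 : finrank K V ≤ finrank K (K ∙ v) + finrank K (LinearMap.range Y) := by
    rw [← finrank_top K V, ← htop]
    exact Submodule.finrank_add_le_finrank_add_finrank _ _
  have h2 : finrank K (K ∙ v) ≤ 1 := by
    simpa using finrank_span_le_card (R := K) ({v} : Set V)
  have h3 := LinearMap.finrank_range_add_finrank_ker Y
  have h4 : X.eigenspace μ = LinearMap.ker Y := Module.End.eigenspace_def
  rw [h4]
  omega

open Module in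
/-- In a basis where an operator is upper Hessenberg with nonzero subdiagonal, the first basis
vector is cyclic. -/
theorem Module.Basis.cyclic_of_hessenberg {K V : Type*} [Field K] [AddCommGroup V] [Module K V]
    {n : ℕ} (b : Basis (Fin (n + 1)) K V) (X : End K V)
    (hsub : ∀ i j : Fin (n + 1), (i : ℕ) = j + 1 → b.repr (X (b j)) i ≠ 0)
    (hzero : ∀ i j : Fin (n + 1), (j : ℕ) + 1 < i → b.repr (X (b j)) i = 0)
    (W : Submodule K V) (h0 : b 0 ∈ W) (hW : ∀ w ∈ W, X w ∈ W) : W = ⊤ := by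
  have hmem : ∀ m (hm : m < n + 1), b ⟨m, hm⟩ ∈ W := by
    intro m
    induction m using Nat.strong_induction_on with
    | _ m ih =>
      intro hm
      cases m with
      | zero => exact h0
      | succ m =>
        set i : Fin (n + 1) := ⟨m + 1, hm⟩
        set j : Fin (n + 1) := ⟨m, by omega⟩
        have hXj := hW _ (ih m (by omega) (by omega))
        rw [← b.sum_repr (X (b j)), ← Finset.add_sum_erase _ _ (Finset.mem_univ i)] at hXj
        have hrest : ∑ l ∈ Finset.univ.erase i, b.repr (X (b j)) l • b l ∈ W := by
          refine W.sum_mem fun l hl => ?_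
          rcases Nat.lt_or_ge (m + 1) l with h | h
          · rw [hzero l j h, zero_smul]
            exact W.zero_mem
          · have : (l : ℕ) ≠ m + 1 := fun h => Finset.ne_of_mem_erase hl (Fin.ext h)
            exact W.smul_mem _ (ih l (by omega) l.2)
        exact (W.smul_mem_iff (hsub i j rfl)).1 ((W.add_mem_iff_left hrest).1 hXj)
  rw [eq_top_iff, ← b.span_eq, Submodule.span_le]
  rintro _ ⟨i, rfl⟩
  exact hmem i i.2

open Module in
theorem Module.End.iSup_eigenspace_eq_top_of_isDiag {K V : Type*} [Field K] [AddCommGroup V]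
    [Module K V] {n : ℕ} (b : Basis (Fin n) K V) (X : End K V)
    (h : (LinearMap.toMatrix b b X).IsDiag) : ⨆ μ : K, X.eigenspace μ = ⊤ := by
  rw [eq_top_iff, ← b.span_eq, Submodule.span_le]
  rintro _ ⟨i, rfl⟩
  refine Submodule.mem_iSup_of_mem (b.repr (X (b i)) i) ?_
  rw [Module.End.mem_eigenspace_iff]
  conv_lhs => rw [← b.sum_repr (X (b i))]
  refine Finset.sum_eq_single _ (fun j _ hj => ?_) (by simp)
  have : b.repr (X (b i)) j = 0 := by simpa [LinearMap.toMatrix_apply] using h hj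
  rw [this, zero_smul]

open Module in
/-- A multiplicity-free operator over an algebraically closed field has an eigenbasis with
distinct eigenvalues. -/
theorem Module.End.exists_eigenbasis_of_multFree {K V : Type*} [Field K] [IsAlgClosed K]
    [AddCommGroup V] [Module K V] [FiniteDimensional K V] (X : End K V)
    (h : ∀ μ, X.HasEigenvalue μ → finrank K (X.maxGenEigenspace μ) = 1) :
    ∃ b : Basis X.Eigenvalues K V, ∀ μ, X (b μ) = (μ : K) • b μ := by
  choose e he using fun μ : X.Eigenvalues =>
    Module.End.HasEigenvalue.exists_hasEigenvector (f := X) (μ := μ) μ.2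
  have hinj : Function.Injective fun μ : X.Eigenvalues => (μ : K) := Subtype.val_injective
  have hli : LinearIndependent K e := X.eigenvectors_linearIndependent' _ hinj e he
  have hspan : ⊤ ≤ Submodule.span K (Set.range e) := by
    rw [← X.iSup_maxGenEigenspace_eq_top]
    refine iSup_le fun μ => ?_
    by_cases hμ : X.HasEigenvalue μ
    · intro w hw
      have hmem : e ⟨μ, hμ⟩ ∈ X.maxGenEigenspace μ :=
        (X.genEigenspace μ).monotone (le_top : (1 : ℕ∞) ≤ ⊤) (he ⟨μ, hμ⟩).1
      obtain ⟨c, hc⟩ := (finrank_eq_one_iff_of_nonzero' (⟨_, hmem⟩ : X.maxGenEigenspace μ)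
        (by simpa using (he ⟨μ, hμ⟩).2)).1 (h μ hμ) ⟨w, hw⟩
      have : c • e ⟨μ, hμ⟩ = w := congrArg Subtype.val hc
      rw [← this]
      exact Submodule.smul_mem _ _ (Submodule.subset_span ⟨_, rfl⟩)
    · have : X.maxGenEigenspace μ = ⊥ := by
        by_contra hne
        exact hμ (Module.End.HasUnifEigenvalue.lt zero_lt_one (k := ⊤) hne)
      rw [this]
      exact bot_le
  exact ⟨Basis.mk hli hspan, fun μ => by simpa using (he μ).apply_eq_smul⟩

open Module in
theorem Module.End.iSup_eigenspace_eq_top_of_multFree {K V : Type*} [Field K] [IsAlgClosed K]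
    [AddCommGroup V] [Module K V] [FiniteDimensional K V] (X : End K V)
    (h : ∀ μ, X.HasEigenvalue μ → finrank K (X.maxGenEigenspace μ) = 1) :
    ⨆ μ : K, X.eigenspace μ = ⊤ := by
  obtain ⟨b, hb⟩ := X.exists_eigenbasis_of_multFree h
  rw [eq_top_iff, ← b.span_eq, Submodule.span_le]
  rintro _ ⟨μ, rfl⟩
  exact Submodule.mem_iSup_of_mem (μ : K) (Module.End.mem_eigenspace_iff.2 (hb μ))

open Module in
/-- A proper nonempty set of basis vectors cannot span a common invariant subspace of a pair of
operators acting irreducibly. -/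
theorem Module.Basis.exists_repr_ne_zero_of_irreducible {K V ι : Type*} [Field K] [AddCommGroup V]
    [Module K V] (b : Basis ι K V) {X Y : End K V}
    (hirr : ∀ W : Submodule K V, (∀ w ∈ W, X w ∈ W) → (∀ w ∈ W, Y w ∈ W) → W = ⊥ ∨ W = ⊤)
    {U : Set ι} (hne : U.Nonempty) (hU : U ≠ Set.univ) :
    ∃ t ∈ U, ∃ s ∉ U, b.repr (X (b t)) s ≠ 0 ∨ b.repr (Y (b t)) s ≠ 0 := by
  by_contra! h
  have hinv : ∀ Z : End K V, (∀ t ∈ U, ∀ s ∉ U, b.repr (Z (b t)) s = 0) →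
      ∀ w ∈ Submodule.span K (b '' U), Z w ∈ Submodule.span K (b '' U) := by
    intro Z hZ w hw
    have hle : Submodule.span K (b '' U) ≤ (Submodule.span K (b '' U)).comap Z := by
      rw [Submodule.span_le]
      rintro _ ⟨t, ht, rfl⟩
      refine b.mem_span_image.2 fun s hs => ?_
      by_contra hsU
      exact (Finsupp.mem_support_iff.1 hs) (hZ t ht s hsU)
    exact hle hw
  rcases hirr _ (hinv X fun t ht s hs => (h t ht s hs).1)
    (hinv Y fun t ht s hs => (h t ht s hs).2) with hbot | htop
  · obtain ⟨t, ht⟩ := hne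
    have : b t ∈ Submodule.span K (b '' U) := Submodule.subset_span ⟨t, ht, rfl⟩
    rw [hbot, Submodule.mem_bot] at this
    exact b.ne_zero t this
  · refine hU (Set.eq_univ_of_forall fun s => ?_)
    have : b s ∈ Submodule.span K (b '' U) := htop ▸ Submodule.mem_top
    exact b.self_mem_span_image.1 this

open Module in
/-- The cubic relation between `X` and `Y` forces matrix entries of `Y` in an `X`-eigenbasis to
vanish unless the eigenvalues satisfy a quadratic relation. -/
theorem Module.Basis.eigenvalue_relation_of_repr_ne_zero {K V ι : Type*} [Field K]
    [AddCommGroup V] [Module K V] (b : Basis ι K V) {X Y : End K V} {μ : ι → K}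
    (hX : ∀ i, X (b i) = μ i • b i) (hμ : Function.Injective μ)
    (hXY : Commute (X * X * Y - 2 * (X * Y * X) + Y * X * X - 2 * (X * Y) - 2 * (Y * X)) X)
    {s t : ι} (hst : s ≠ t) (h : b.repr (Y (b t)) s ≠ 0) :
    (μ s - μ t) ^ 2 = 2 * (μ s + μ t) := by
  have hrepr : ∀ w, b.repr (X w) s = μ s * b.repr w s := by
    intro w
    have : (b.coord s) ∘ₗ X = μ s • b.coord s := by
      refine b.ext fun i => ?_
      by_cases his : i = s
      · subst his
        simp [hX]
      · simp [hX, his]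
    simpa using LinearMap.congr_fun this w
  set P := X * X * Y - 2 * (X * Y * X) + Y * X * X - 2 * (X * Y) - 2 * (Y * X) with hP
  have h1 : P (X (b t)) = X (P (b t)) := LinearMap.congr_fun hXY (b t)
  have h2 : (μ s - μ t) * b.repr (P (b t)) s = 0 := by
    have := congrArg (fun w => b.repr w s) h1
    simp only [hX, map_smul, Finsupp.smul_apply, smul_eq_mul, hrepr] at this
    linear_combination -this
  have h3 : b.repr (P (b t)) s = 0 :=
    (mul_eq_zero.1 h2).resolve_left (sub_ne_zero.2 (hμ.ne hst))
  have h4 : P (b t) = X (X (Y (b t))) - (2 : K) • X (Y (X (b t))) + Y (X (X (b t)))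
      - (2 : K) • X (Y (b t)) - (2 : K) • Y (X (b t)) := by
    simp [hP, Module.End.mul_apply, two_mul, two_smul]
  rw [h4] at h3
  simp only [hX, map_smul, map_sub, map_add, Finsupp.sub_apply, Finsupp.add_apply,
    Finsupp.smul_apply, smul_eq_mul, hrepr] at h3
  refine mul_right_cancel₀ h ?_
  linear_combination h3

open Module in
/-- If `X` is multiplicity-free and `X`, `Y` act irreducibly and satisfy the cubic relation, then
`Y` is irreducible tridiagonal in some eigenbasis of `X`. -/
theorem exists_isDiag_isIrrTridiag {K : Type} {V : Type*} [Field K] [IsAlgClosed K] [CharZero K]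
    [AddCommGroup V] [Module K V] [FiniteDimensional K V] [Nontrivial V] {X Y : End K V}
    (hmf : ∀ μ, X.HasEigenvalue μ → finrank K (X.maxGenEigenspace μ) = 1)
    (hirr : ∀ W : Submodule K V, (∀ w ∈ W, X w ∈ W) → (∀ w ∈ W, Y w ∈ W) → W = ⊥ ∨ W = ⊤)
    (hXY : Commute (X * X * Y - 2 * (X * Y * X) + Y * X * X - 2 * (X * Y) - 2 * (Y * X)) X) :
    ∃ (n : ℕ) (b : Basis (Fin n) K V), (LinearMap.toMatrix b b X).IsDiag ∧
      IsIrrTridiag K (LinearMap.toMatrix b b Y) := by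
  classical
  obtain ⟨e, he⟩ := X.exists_eigenbasis_of_multFree hmf
  have hinj : Function.Injective fun μ : X.Eigenvalues => (μ : K) := Subtype.val_injective
  have hXe : ∀ s t, s ≠ t → e.repr (X (e t)) s = 0 := fun s t hst => by
    rw [he]
    simp [hst.symm]
  obtain ⟨k, θ, hθinj, hθmem, hθclosed, hθadj⟩ := exists_racahEig_path
    (Finset.univ.image fun μ : X.Eigenvalues => (μ : K))
    ((Finset.univ_nonempty_iff.2 e.index_nonempty).image _)
  have hθmem' : ∀ i, ∃ μ : X.Eigenvalues, (μ : K) = θ i := fun i => by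
    simpa using hθmem i
  choose σ hσ using hθmem'
  have hσinj : Function.Injective σ := fun i j hij => hθinj (by rw [← hσ, ← hσ, hij])
  have hσsurj : Function.Surjective σ := by
    rw [← Set.range_eq_univ]
    by_contra hne
    obtain ⟨_, ⟨i, rfl⟩, s, hs, h⟩ :=
      e.exists_repr_ne_zero_of_irreducible hirr (Set.range_nonempty σ) hne
    have hsi : s ≠ σ i := fun h => hs ⟨i, h.symm⟩
    have hrel := e.eigenvalue_relation_of_repr_ne_zero he hinj hXY hsi
      (h.resolve_left fun h => h (hXe _ _ hsi))
    obtain ⟨j, hj⟩ := hθclosed i s (by simp) (by rw [← hσ]; exact hrel)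
    exact hs ⟨j, hinj (by simp only [hσ, hj])⟩
  let b := e.reindex (Equiv.ofBijective σ ⟨hσinj, hσsurj⟩).symm
  have hb : ∀ i, b i = e (σ i) := fun i => by
    simp only [b, Basis.reindex_apply, Equiv.symm_symm]
    rfl
  have hXb : ∀ i, X (b i) = θ i • b i := fun i => by rw [hb, he, hσ]
  have hX0 : ∀ s t, s ≠ t → b.repr (X (b t)) s = 0 := fun s t hst => by
    rw [hXb]
    simp [hst.symm]
  have htri : ∀ s t : Fin (k + 1), b.repr (Y (b t)) s ≠ 0 →
      (s : ℕ) = t ∨ (s : ℕ) = t + 1 ∨ (t : ℕ) = s + 1 := by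
    intro s t h
    by_cases hst : s = t
    · exact Or.inl (congrArg _ hst)
    · exact Or.inr (hθadj s t hst (b.eigenvalue_relation_of_repr_ne_zero hXb hθinj hXY hst h))
  refine ⟨k + 1, b, fun i j hij => ?_, fun i j h => ?_, fun i j hij => ?_⟩
  · simpa only [LinearMap.toMatrix_apply] using hX0 i j hij
  · rw [LinearMap.toMatrix_apply] at h
    exact htri i j h
  · rw [LinearMap.toMatrix_apply]
    intro h0
    rcases hij with hij | hij
    · obtain ⟨t, ht, s, hs, h⟩ := b.exists_repr_ne_zero_of_irreducible hirr (U := Set.Iic j)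
        ⟨j, le_refl j⟩ (fun h => by
          have : i ∈ Set.Iic j := h ▸ Set.mem_univ i
          simp only [Set.mem_Iic, Fin.le_def] at this
          omega)
      simp only [Set.mem_Iic, Fin.le_def] at ht hs
      have h := h.resolve_left fun h => h (hX0 s t (fun h => by subst h; omega))
      have := htri s t h
      obtain rfl : s = i := Fin.ext (by omega)
      obtain rfl : t = j := Fin.ext (by omega)
      exact h h0
    · obtain ⟨t, ht, s, hs, h⟩ := b.exists_repr_ne_zero_of_irreducible hirr (U := Set.Ici j)
        ⟨j, le_refl j⟩ (fun h => by
          have : i ∈ Set.Ici j := h ▸ Set.mem_univ i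
          simp only [Set.mem_Ici, Fin.le_def] at this
          omega)
      simp only [Set.mem_Ici, Fin.le_def] at ht hs
      have h := h.resolve_left fun h => h (hX0 s t (fun h => by subst h; omega))
      have := htri s t h
      obtain rfl : s = i := Fin.ext (by omega)
      obtain rfl : t = j := Fin.ext (by omega)
      exact h h0

open Module in
theorem isIrrTridiag_of_add_eq_smul {K : Type} {V : Type*} [Field K] [AddCommGroup V]
    [Module K V] {n : ℕ} {b : Basis (Fin n) K V} {X Y Z : End K V} {c : K}
    (hsum : X + Y + Z = c • 1) (hX : (LinearMap.toMatrix b b X).IsDiag)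
    (hY : IsIrrTridiag K (LinearMap.toMatrix b b Y)) :
    IsIrrTridiag K (LinearMap.toMatrix b b Z) := by
  have hentry : ∀ i j, i ≠ j → LinearMap.toMatrix b b Z i j = -LinearMap.toMatrix b b Y i j := by
    intro i j hij
    have h := congrArg (fun T => LinearMap.toMatrix b b T i j) hsum
    simp only [map_add, map_smul, LinearMap.toMatrix_one, Matrix.add_apply, Matrix.smul_apply,
      Matrix.one_apply_ne hij, smul_zero, hX hij, zero_add] at h
    exact eq_neg_of_add_eq_zero_right h
  refine ⟨fun i j h => ?_, fun i j h => ?_⟩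
  · by_cases hij : i = j
    · exact Or.inl (congrArg _ hij)
    · rw [hentry i j hij] at h
      exact hY.1 i j (neg_ne_zero.1 h)
  · have hij : i ≠ j := fun hij => by subst hij; omega
    rw [hentry i j hij]
    exact neg_ne_zero.2 (hY.2 i j h)

open Module in
/-- A diagonalizable operator that is irreducible tridiagonal in some basis is
multiplicity-free. -/
theorem multFree_of_isDiag_of_isIrrTridiag {K : Type} {V : Type*} [Field K] [AddCommGroup V]
    [Module K V] {n m : ℕ} {b : Basis (Fin n) K V} {b' : Basis (Fin m) K V} {X : End K V}
    (hX : (LinearMap.toMatrix b b X).IsDiag) (hX' : IsIrrTridiag K (LinearMap.toMatrix b' b' X))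
    (μ : K) (hμ : X.HasEigenvalue μ) : finrank K (X.maxGenEigenspace μ) = 1 := by
  have : FiniteDimensional K V := b.finiteDimensional_of_finite
  have hdiag := X.iSup_eigenspace_eq_top_of_isDiag b hX
  cases m with
  | zero =>
    obtain ⟨w, hw⟩ := hμ.exists_hasEigenvector
    have := b'.repr.injective.subsingleton
    exact absurd (Subsingleton.elim w 0) hw.2
  | succ m =>
    refine X.finrank_maxGenEigenspace_of_cyclic hdiag (v := b' 0) (fun W h0 hW =>
      b'.cyclic_of_hessenberg X (fun i j hij => ?_) (fun i j hij => ?_) W h0 hW) hμ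
    · rw [← LinearMap.toMatrix_apply]
      exact hX'.2 i j (Or.inl hij)
    · rw [← LinearMap.toMatrix_apply]
      by_contra h
      have := hX'.1 i j h
      omega

theorem racah_commute {R : Type*} [Ring R] {x y z w s : R} (hs : x + y + z = s)
    (hsx : Commute s x) (hw : x * y - y * x = 2 * w)
    (h : Commute (x * w - w * x + x * z - y * x) x) :
    Commute (x * x * y - 2 * (x * y * x) + y * x * x - 2 * (x * y) - 2 * (y * x)) x := by
  have key : x * x * y - 2 * (x * y * x) + y * x * x - 2 * (x * y) - 2 * (y * x)
      = 2 * (x * w - w * x + x * z - y * x) - 2 * (x * s) + 2 * (x * x) := by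
    have h1 : x * (x * y - y * x) - (x * y - y * x) * x = 2 * (x * w - w * x) := by
      rw [hw]
      noncomm_ring
    have h2 : 2 * (x * w - w * x + x * z - y * x)
        = x * (x * y - y * x) - (x * y - y * x) * x + 2 * (x * z - y * x) := by
      rw [h1]
      noncomm_ring
    rw [h2, ← hs]
    noncomm_ring
  rw [key]
  have h2 : Commute (2 : R) x := Commute.ofNat_left 2 x
  exact ((h2.mul_left h).sub_left (h2.mul_left ((Commute.refl x).mul_left hsx))).add_left
    (h2.mul_left ((Commute.refl x).mul_left (Commute.refl x)))

section Racah

variable {F : Type} [Field F]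

theorem RacahAlg.rel_AB : rA F * rB F - rB F * rA F = 2 * rD F := by
  simpa [two_mul, rA, rB, rD] using RingQuot.mkAlgHom_rel F (RacahRel.AB (F := F))

theorem RacahAlg.rel_BC : rB F * rC F - rC F * rB F = 2 * rD F := by
  simpa [two_mul, rB, rC, rD] using RingQuot.mkAlgHom_rel F (RacahRel.BC (F := F))

theorem RacahAlg.rel_CA : rC F * rA F - rA F * rC F = 2 * rD F := by
  simpa [two_mul, rA, rC, rD] using RingQuot.mkAlgHom_rel F (RacahRel.CA (F := F))

theorem RacahAlg.commute_alpha :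
    Commute (rA F * rD F - rD F * rA F + rA F * rC F - rB F * rA F) (rA F) := by
  simpa [commute_iff_eq, alphaFree, rA, rB, rC, rD] using
    RingQuot.mkAlgHom_rel F (RacahRel.alphaC (F := F) 0)

theorem RacahAlg.commute_beta :
    Commute (rB F * rD F - rD F * rB F + rB F * rA F - rC F * rB F) (rB F) := by
  simpa [commute_iff_eq, betaFree, rA, rB, rC, rD] using
    RingQuot.mkAlgHom_rel F (RacahRel.betaC (F := F) 1)

theorem RacahAlg.commute_gamma :
    Commute (rC F * rD F - rD F * rC F + rC F * rB F - rA F * rC F) (rC F) := by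
  simpa [commute_iff_eq, gammaFree, rA, rB, rC, rD] using
    RingQuot.mkAlgHom_rel F (RacahRel.gammaC (F := F) 2)

/-- A subspace stable under `A`, `B`, `C`, `D` is stable under the universal Racah algebra. -/
theorem RacahAlg.smul_mem {V : Type*} [AddCommGroup V] [Module F V] [Module (RacahAlg F) V]
    [IsScalarTower F (RacahAlg F) V] {W : Submodule F V}
    (hA : ∀ w ∈ W, rA F • w ∈ W) (hB : ∀ w ∈ W, rB F • w ∈ W) (hC : ∀ w ∈ W, rC F • w ∈ W)
    (hD : ∀ w ∈ W, rD F • w ∈ W) (r : RacahAlg F) : ∀ w ∈ W, r • w ∈ W := by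
  obtain ⟨p, rfl⟩ := RingQuot.mkAlgHom_surjective F (RacahRel F) r
  induction p using FreeAlgebra.induction with
  | grade0 c =>
    intro w hw
    rw [AlgHom.commutes, algebraMap_smul]
    exact W.smul_mem c hw
  | grade1 i =>
    fin_cases i
    · exact hA
    · exact hB
    · exact hC
    · exact hD
  | mul p q hp hq =>
    intro w hw
    rw [map_mul, mul_smul]
    exact hp _ (hq _ hw)
  | add p q hp hq =>
    intro w hw
    rw [map_add, add_smul]
    exact W.add_mem (hp _ hw) (hq _ hw)

/-- On a simple module where `δ` is scalar, `A` and `B` act irreducibly. -/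
theorem RacahAlg.eq_bot_or_eq_top [CharZero F] {V : Type*} [AddCommGroup V] [Module F V]
    [Module (RacahAlg F) V] [IsScalarTower F (RacahAlg F) V] [IsSimpleModule (RacahAlg F) V]
    {c : F} (hδ : ∀ u : V, rDelta F • u = c • u) (W : Submodule F V)
    (hA : ∀ w ∈ W, rA F • w ∈ W) (hB : ∀ w ∈ W, rB F • w ∈ W) : W = ⊥ ∨ W = ⊤ := by
  have hC : ∀ w ∈ W, rC F • w ∈ W := by
    intro w hw
    have h : rC F • w = c • w - rA F • w - rB F • w := by
      rw [← hδ, rDelta, add_smul, add_smul]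
      abel
    rw [h]
    exact W.sub_mem (W.sub_mem (W.smul_mem c hw) (hA w hw)) (hB w hw)
  have hD : ∀ w ∈ W, rD F • w ∈ W := by
    intro w hw
    have h : (2 : F) • rD F • w = rA F • rB F • w - rB F • rA F • w := by
      rw [← mul_smul, ← mul_smul, ← sub_smul, rel_AB, mul_smul, two_smul, two_smul]
    refine (W.smul_mem_iff (two_ne_zero (α := F))).1 ?_
    rw [h]
    exact W.sub_mem (hA _ (hB w hw)) (hB _ (hA w hw))
  let W' : Submodule (RacahAlg F) V :=
    { W with smul_mem' := fun r w hw => RacahAlg.smul_mem hA hB hC hD r w hw }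
  rcases IsSimpleOrder.eq_bot_or_eq_top W' with h | h
  · refine Or.inl (SetLike.ext fun w => ?_)
    exact SetLike.ext_iff.1 h w
  · refine Or.inr (SetLike.ext fun w => ?_)
    exact SetLike.ext_iff.1 h w

variable {V : Type} [AddCommGroup V] [Module F V] [Module (RacahAlg F) V]
  [IsScalarTower F (RacahAlg F) V]

theorem opOf_apply (x : RacahAlg F) (u : V) : opOf F x V u = x • u := rfl

theorem opOf_eq_lsmul (x : RacahAlg F) : opOf F x V = Algebra.lsmul F F V x := rfl

/-- If `x`, `y`, `z` satisfy the relations of the universal Racah algebra, `x + y + z` is scalar and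
`x` is multiplicity-free, then `y` and `z` are irreducible tridiagonal in some eigenbasis of `x`. -/
theorem exists_basis_of_racah_relations [IsAlgClosed F] [CharZero F] [FiniteDimensional F V]
    [Nontrivial V] {x y z w : RacahAlg F} {c : F}
    (hsum : ∀ u : V, (x + y + z) • u = c • u)
    (hw : x * y - y * x = 2 * w)
    (hx : Commute (x * w - w * x + x * z - y * x) x)
    (hirr : ∀ W : Submodule F V, (∀ u ∈ W, x • u ∈ W) → (∀ u ∈ W, y • u ∈ W) → W = ⊥ ∨ W = ⊤)
    (hmf : ∀ μ, (opOf F x V).HasEigenvalue μ →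
      Module.finrank F ((opOf F x V).maxGenEigenspace μ) = 1) :
    ∃ (n : ℕ) (b : Module.Basis (Fin n) F V),
      (LinearMap.toMatrix b b (opOf F x V)).IsDiag ∧
      IsIrrTridiag F (LinearMap.toMatrix b b (opOf F y V)) ∧
      IsIrrTridiag F (LinearMap.toMatrix b b (opOf F z V)) := by
  have hsum' : opOf F x V + opOf F y V + opOf F z V = c • 1 := by
    ext u
    simpa [add_smul, opOf_apply] using hsum u
  obtain ⟨n, b, hX, hY⟩ := exists_isDiag_isIrrTridiag (Y := opOf F y V) hmf hirr
    (racah_commute hsum' ((Commute.one_left _).smul_left c)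
      (w := opOf F w V)
      (by simpa [two_mul, opOf_eq_lsmul] using congrArg (Algebra.lsmul F F V) hw)
      (by simpa [opOf_eq_lsmul] using hx.map (Algebra.lsmul F F V)))
  exact ⟨n, b, hX, hY, isIrrTridiag_of_add_eq_smul hsum' hX hY⟩

end Racah

/-- Suppose `R_d(a,b,c)` is irreducible.  TFAE: (i) `A, B, C` act
diagonalizably; (ii) `A, B, C` act multiplicity-freely; (iii) `A, B, C` act as a Leonard
triple. -/
theorem stmt11 (F : Type) [Field F] [IsAlgClosed F] [CharZero F] (d : ℕ) (a b c : F)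
    (V : Type) [AddCommGroup V] [Module (RacahAlg F) V]
    (hV : IsRdModule F a b c d V) (hirr : IsSimpleModule (RacahAlg F) V) :
    ((ActsDiagOn F (rA F) V ∧ ActsDiagOn F (rB F) V ∧ ActsDiagOn F (rC F) V) ↔
      (ActsMultFreeOn F (rA F) V ∧ ActsMultFreeOn F (rB F) V ∧ ActsMultFreeOn F (rC F) V)) ∧
    ((ActsMultFreeOn F (rA F) V ∧ ActsMultFreeOn F (rB F) V ∧ ActsMultFreeOn F (rC F) V) ↔
      ActsAsLeonardTripleOn F (rA F) (rB F) (rC F) V) := by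
  let _ := resF F (RacahAlg F) V
  have := resF_tower F (RacahAlg F) V rfl
  obtain ⟨v, hA, hB, hscalar⟩ := hV
  obtain ⟨δ, hδ⟩ : ∃ δ : F, ∀ u : V, rDelta F • u = δ • u := ⟨_, hscalar⟩
  have : FiniteDimensional F V := v.finiteDimensional_of_finite
  have : Nontrivial V := IsSimpleModule.nontrivial (RacahAlg F) V
  have hsumC : ∀ u : V, (rA F + rB F + rC F) • u = δ • u := hδ
  have hsumA : ∀ u : V, (rB F + rC F + rA F) • u = δ • u := fun u => by
    rw [← hδ u, rDelta, add_rotate (rA F)]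
  have hsumB : ∀ u : V, (rC F + rA F + rB F) • u = δ • u := fun u => by
    rw [← hδ u, rDelta, add_rotate (rC F)]
  have hirrAB := RacahAlg.eq_bot_or_eq_top hδ
  have hC_smul : ∀ u : V, rC F • u = δ • u - rA F • u - rB F • u := fun u => by
    rw [← hδ u, rDelta, add_smul, add_smul]
    abel
  have hirrBC : ∀ W : Submodule F V, (∀ u ∈ W, rB F • u ∈ W) → (∀ u ∈ W, rC F • u ∈ W) →
      W = ⊥ ∨ W = ⊤ := by
    refine fun W h1 h2 => hirrAB W (fun u hu => ?_) h1
    have h : rA F • u = δ • u - rC F • u - rB F • u := by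
      rw [hC_smul]
      abel
    rw [h]
    exact W.sub_mem (W.sub_mem (W.smul_mem _ hu) (h2 u hu)) (h1 u hu)
  have hirrCA : ∀ W : Submodule F V, (∀ u ∈ W, rC F • u ∈ W) → (∀ u ∈ W, rA F • u ∈ W) →
      W = ⊥ ∨ W = ⊤ := by
    refine fun W h1 h2 => hirrAB W h2 (fun u hu => ?_)
    have h : rB F • u = δ • u - rA F • u - rC F • u := by
      rw [hC_smul]
      abel
    rw [h]
    exact W.sub_mem (W.sub_mem (W.smul_mem _ hu) (h2 u hu)) (h1 u hu)
  have hAr : ∀ s t, v.repr (rA F • v t) s =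
      (if s = t then thP F a d t else 0) + if (s : ℕ) = t + 1 then 1 else 0 := by
    intro s t
    rw [hA, map_add, map_smul, Finsupp.add_apply, Finsupp.smul_apply, v.repr_self,
      Finsupp.single_apply, smul_eq_mul, mul_ite, mul_one, mul_zero]
    refine congrArg₂ _ (if_congr eq_comm rfl rfl) ?_
    split_ifs with h1 h2 h2
    · rw [v.repr_self, Finsupp.single_apply, if_pos (Fin.ext h2.symm)]
    · rw [v.repr_self, Finsupp.single_apply, if_neg fun h => h2 (by rw [← h])]
    · omega
    · simp
  have hBr : ∀ s t, v.repr (rB F • v t) s =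
      (if s = t then thP F b d t else 0) + if (t : ℕ) = s + 1 then phP F a b c d t else 0 := by
    intro s t
    rw [hB, map_add, map_smul, Finsupp.add_apply, Finsupp.smul_apply, v.repr_self,
      Finsupp.single_apply, smul_eq_mul, mul_ite, mul_one, mul_zero]
    refine congrArg₂ _ (if_congr eq_comm rfl rfl) ?_
    split_ifs with h1 h2 h2
    · omega
    · simp
    · simp [h2]
    · have h3 : ¬ (t : ℕ) - 1 = s := by omega
      simp [Fin.ext_iff, h3]
  have hφ : ∀ s t : Fin (d + 1), (t : ℕ) = s + 1 → phP F a b c d t ≠ 0 := by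
    intro s t hst h0
    obtain ⟨i, hi, j, hj, h⟩ := v.exists_repr_ne_zero_of_irreducible
      (X := opOf F (rA F) V) (Y := opOf F (rB F) V) hirrAB (U := Set.Ici t)
      ⟨t, le_refl t⟩ (fun h => by
        have : s ∈ Set.Ici t := h ▸ Set.mem_univ s
        simp only [Set.mem_Ici, Fin.le_def] at this
        omega)
    simp only [Set.mem_Ici, Fin.le_def] at hi hj
    rw [opOf_apply, opOf_apply, hAr, hBr] at h
    have hij : j ≠ i := fun h => by subst h; omega
    have hij' : (j : ℕ) ≠ i + 1 := by omega
    simp only [hij, hij', if_false, add_zero, zero_add, ne_eq, not_true, false_or] at h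
    split_ifs at h with hi'
    · obtain rfl : i = t := Fin.ext (by omega)
      exact h h0
    · exact h rfl
  have hCr : ∀ s t, s ≠ t → v.repr (rC F • v t) s =
      -(if (s : ℕ) = t + 1 then 1 else 0) - if (t : ℕ) = s + 1 then phP F a b c d t else 0 := by
    intro s t hst
    rw [hC_smul]
    simp [hAr, hBr, hst]
  have hcycA : ∀ W : Submodule F V, v 0 ∈ W → (∀ w ∈ W, opOf F (rA F) V w ∈ W) → W = ⊤ := by
    refine v.cyclic_of_hessenberg _ (fun i j hij => ?_) (fun i j hij => ?_)
    all_goals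
      have h : i ≠ j := fun h => by subst h; omega
      rw [opOf_apply, hAr, if_neg h]
    · simp [hij]
    · rw [if_neg (by omega), add_zero]
  have hcycC : ∀ W : Submodule F V, v 0 ∈ W → (∀ w ∈ W, opOf F (rC F) V w ∈ W) → W = ⊤ := by
    refine v.cyclic_of_hessenberg _ (fun i j hij => ?_) (fun i j hij => ?_)
    all_goals
      have h : i ≠ j := fun h => by subst h; omega
      rw [opOf_apply, hCr i j h, if_neg (by omega : ¬ (j : ℕ) = i + 1)]
    · simp [hij]
    · rw [if_neg (by omega), neg_zero, sub_zero]
  have hcycB : ∀ W : Submodule F V, v.reindex Fin.revPerm 0 ∈ W →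
      (∀ w ∈ W, opOf F (rB F) V w ∈ W) → W = ⊤ := by
    refine (v.reindex Fin.revPerm).cyclic_of_hessenberg _ (fun i j hij => ?_) (fun i j hij => ?_)
    all_goals
      have h : i.rev ≠ j.rev := fun h => by
        have := Fin.rev_injective h
        subst this
        omega
      have hi := Fin.val_rev i
      have hj := Fin.val_rev j
      simp only [opOf_apply, Module.Basis.repr_reindex_apply, Module.Basis.reindex_apply,
        Fin.revPerm_symm, Fin.revPerm_apply, hBr, if_neg h, zero_add]
    · have hij' : (j.rev : ℕ) = i.rev + 1 := by omega
      rw [if_pos hij']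
      exact hφ _ _ hij'
    · rw [if_neg (by omega)]
  refine ⟨⟨fun ⟨h1, h2, h3⟩ => ⟨fun μ hμ => ?_, fun μ hμ => ?_, fun μ hμ => ?_⟩,
    fun ⟨h1, h2, h3⟩ => ⟨?_, ?_, ?_⟩⟩, fun ⟨h1, h2, h3⟩ => ⟨?_, ?_, ?_⟩, ?_⟩
  · exact Module.End.finrank_maxGenEigenspace_of_cyclic h1 hcycA hμ
  · exact Module.End.finrank_maxGenEigenspace_of_cyclic h2 hcycB hμ
  · exact Module.End.finrank_maxGenEigenspace_of_cyclic h3 hcycC hμ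
  · exact Module.End.iSup_eigenspace_eq_top_of_multFree _ h1
  · exact Module.End.iSup_eigenspace_eq_top_of_multFree _ h2
  · exact Module.End.iSup_eigenspace_eq_top_of_multFree _ h3
  · exact exists_basis_of_racah_relations hsumC RacahAlg.rel_AB RacahAlg.commute_alpha hirrAB h1
  · exact exists_basis_of_racah_relations hsumA RacahAlg.rel_BC RacahAlg.commute_beta hirrBC h2
  · exact exists_basis_of_racah_relations hsumB RacahAlg.rel_CA RacahAlg.commute_gamma hirrCA h3
  · rintro ⟨⟨_, _, hA1, hB1, -⟩, ⟨_, _, hB2, hC2, hA2⟩, ⟨_, _, hC3, -, -⟩⟩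
    exact ⟨fun μ hμ => multFree_of_isDiag_of_isIrrTridiag hA1 hA2 μ hμ,
      fun μ hμ => multFree_of_isDiag_of_isIrrTridiag hB2 hB1 μ hμ,
      fun μ hμ => multFree_of_isDiag_of_isIrrTridiag hC3 hC2 μ hμ⟩
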